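/- arXiv:2505.03243 — 7 statements merged into one kernel-verified Lean document; each statement's English description precedes it below -/
import Mathlib

section
/- Let (P, ≤) be a partially ordered set, l : P → ℕ a strictly monotone function, and x ∈ P. Then the collection {l(C) : C a chain ending at x} of finite subsets of ℕ is nonempty and finite, and consequently it has a greatest element with respect to the lexicographical order; that is, there exists a chain C₀ ending at x such that l(C) ≤ l(C₀) lexicographically for every chain C ending at x. In particular the Gabriel–Roiter measure l*(x) is well defined. -/
/-- The lexicographical order on finite subsets of `ℕ`: `X ≤ Y` iff
`min (Y \ X) ≤ min (X \ Y)`, where the minimum of the empty set is `+∞`. -/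
def lexLe (X Y : Finset ℕ) : Prop := (Y \ X).min ≤ (X \ Y).min

/-- The strict lexicographical order on finite subsets of `ℕ`. -/
def lexLt (X Y : Finset ℕ) : Prop := lexLe X Y ∧ X ≠ Y

/-- A (finite) chain in a poset `P` ending at `x`: a finite subset of `P` that is totally
ordered by `≤` and has greatest element `x`. -/
def IsChainEnding {P : Type*} [PartialOrder P] (C : Finset P) (x : P) : Prop :=
  x ∈ C ∧ (∀ a ∈ C, a ≤ x) ∧ ∀ a ∈ C, ∀ b ∈ C, a ≤ b ∨ b ≤ a

/-- `S` is the Gabriel–Roiter measure `l*(x)` of `x` with respect to `l`: `S` is the image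
`l C₀` of some chain `C₀` ending at `x`, and is lexicographically greatest among the images
of chains ending at `x`. -/
def IsGRMeasureAt {P : Type*} [PartialOrder P] (l : P → ℕ) (x : P) (S : Finset ℕ) : Prop :=
  (∃ C : Finset P, IsChainEnding C x ∧ C.image l = S) ∧
  ∀ C : Finset P, IsChainEnding C x → lexLe (C.image l) S

open Finset in
theorem lexLe_iff_forall_exists_le {X Y : Finset ℕ} :
    lexLe X Y ↔ ∀ a ∈ X, a ∉ Y → ∃ b ∈ Y, b ∉ X ∧ b ≤ a := by
  unfold lexLe
  constructor
  · intro h a haX haY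
    have hle : (Y \ X).min ≤ a := h.trans (min_le (mem_sdiff.2 ⟨haX, haY⟩))
    obtain ⟨b, hb, hba⟩ := WithTop.le_coe_iff.1 hle
    have hmem := mem_sdiff.1 (mem_of_min hb)
    exact ⟨b, hmem.1, hmem.2, hba⟩
  · intro h
    refine Finset.le_min fun a ha => ?_
    obtain ⟨haX, haY⟩ := mem_sdiff.1 ha
    obtain ⟨b, hbY, hbX, hba⟩ := h a haX haY
    exact (min_le (mem_sdiff.2 ⟨hbY, hbX⟩)).trans (WithTop.coe_le_coe.2 hba)

/-- The lexicographical order on finite subsets of `ℕ` is the colexicographical order on finite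
subsets of `ℕᵒᵈ`. -/
theorem lexLe_iff_toColex_le {X Y : Finset ℕ} :
    lexLe X Y ↔ toColex (X.map OrderDual.toDual.toEmbedding) ≤
      toColex (Y.map OrderDual.toDual.toEmbedding) := by
  rw [lexLe_iff_forall_exists_le, Finset.Colex.toColex_le_toColex]
  simp

/-- A nonempty finite family of finite subsets of `ℕ` has a lexicographically greatest element. -/
theorem Set.Finite.exists_lexLe_greatest {F : Set (Finset ℕ)} (hF : F.Finite)
    (hne : F.Nonempty) : ∃ S ∈ F, ∀ X ∈ F, lexLe X S := by
  obtain ⟨S, hS, hmax⟩ := F.exists_max_image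
    (fun X => toColex (X.map OrderDual.toDual.toEmbedding)) hF hne
  exact ⟨S, hS, fun X hX => lexLe_iff_toColex_le.2 (hmax X hX)⟩

theorem isChainEnding_singleton {P : Type*} [PartialOrder P] (x : P) :
    IsChainEnding {x} x := by
  simp [IsChainEnding]

theorem IsChainEnding.image_subset_range {P : Type*} [PartialOrder P] {l : P → ℕ}
    (hl : StrictMono l) {C : Finset P} {x : P} (hC : IsChainEnding C x) :
    C.image l ⊆ Finset.range (l x + 1) :=
  Finset.image_subset_iff.2 fun a ha =>
    Finset.mem_range_succ_iff.2 (hl.monotone (hC.2.1 a ha))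

/-- The collection of images `l C`, over chains `C` ending at `x`, is nonempty and finite,
and has a lexicographically greatest element; in particular the Gabriel–Roiter measure
`l*(x)` is well defined. -/
theorem grMeasure_wellDefined {P : Type*} [PartialOrder P] (l : P → ℕ)
    (hl : ∀ a b : P, a < b → l a < l b) (x : P) :
    ({S : Finset ℕ | ∃ C : Finset P, IsChainEnding C x ∧ C.image l = S}).Nonempty ∧
    ({S : Finset ℕ | ∃ C : Finset P, IsChainEnding C x ∧ C.image l = S}).Finite ∧
    (∃ C₀ : Finset P, IsChainEnding C₀ x ∧
      ∀ C : Finset P, IsChainEnding C x → lexLe (C.image l) (C₀.image l)) ∧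
    ∃ S : Finset ℕ, IsGRMeasureAt l x S := by
  have hne : {S : Finset ℕ | ∃ C : Finset P, IsChainEnding C x ∧ C.image l = S}.Nonempty :=
    ⟨_, {x}, isChainEnding_singleton x, rfl⟩
  have hfin : {S : Finset ℕ | ∃ C : Finset P, IsChainEnding C x ∧ C.image l = S}.Finite := by
    refine (Finset.range (l x + 1)).powerset.finite_toSet.subset ?_
    rintro _ ⟨C, hC, rfl⟩
    exact Finset.mem_coe.2 (Finset.mem_powerset.2 (hC.image_subset_range fun a b => hl a b))
  obtain ⟨_, ⟨C₀, hC₀, rfl⟩, hmax⟩ := hfin.exists_lexLe_greatest hne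
  have hgreatest : ∀ C : Finset P, IsChainEnding C x → lexLe (C.image l) (C₀.image l) :=
    fun C hC => hmax _ ⟨C, hC, rfl⟩
  exact ⟨hne, hfin, ⟨C₀, hC₀, hgreatest⟩, C₀.image l, ⟨C₀, hC₀, rfl⟩, hgreatest⟩
end

section
/- (Property GR1) Let (P, ≤) be a partially ordered set and l : P → ℕ a strictly monotone function, with Gabriel–Roiter measure l*. If x ≤ y in P, then l*(x) ≤ l*(y) in the lexicographical order on finite subsets of ℕ. -/
theorem lexLe_of_subset_left {X Y Z : Finset ℕ} (hXY : X ⊆ Y) (h : lexLe Y Z) : lexLe X Z :=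
  (Finset.min_mono (Finset.sdiff_subset_sdiff subset_rfl hXY)).trans
    (h.trans (Finset.min_mono (Finset.sdiff_subset_sdiff hXY subset_rfl)))

open Classical in
theorem IsChainEnding.insert_of_le {P : Type*} [PartialOrder P] {C : Finset P} {x y : P}
    (hC : IsChainEnding C x) (hxy : x ≤ y) : IsChainEnding (insert y C) y := by
  obtain ⟨-, hmax, htot⟩ := hC
  have hle : ∀ a ∈ insert y C, a ≤ y := by
    intro a ha
    rcases Finset.mem_insert.1 ha with rfl | ha
    · exact le_rfl
    · exact (hmax a ha).trans hxy
  refine ⟨Finset.mem_insert_self y C, hle, fun a ha b hb => ?_⟩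
  rcases Finset.mem_insert.1 ha with rfl | ha
  · exact Or.inr (hle b hb)
  rcases Finset.mem_insert.1 hb with rfl | hb
  · exact Or.inl (hle a ha)
  · exact htot a ha b hb

/-- (GR1) If `x ≤ y` then `l*(x) ≤ l*(y)` in the lexicographical order. -/
theorem grMeasure_GR1 {P : Type*} [PartialOrder P] (l : P → ℕ)
    (hl : ∀ a b : P, a < b → l a < l b) (x y : P) (hxy : x ≤ y)
    (S T : Finset ℕ) (hS : IsGRMeasureAt l x S) (hT : IsGRMeasureAt l y T) :
    lexLe S T := by
  classical
  obtain ⟨⟨C, hC, rfl⟩, -⟩ := hS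
  exact lexLe_of_subset_left (Finset.image_subset_image (Finset.subset_insert y C))
    (hT.2 _ (hC.insert_of_le hxy))
end

section
/- Let (P, ≤) be a partially ordered set and l : P → ℕ a strictly monotone function, with Gabriel–Roiter measure l*. If x < y in P (i.e., x ≤ y and x ≠ y), then l*(x) < l*(y) in the lexicographical order on finite subsets of ℕ. -/
theorem lexLe.mono_left {X X' Y : Finset ℕ} (hX : X ⊆ X') (h : lexLe X' Y) : lexLe X Y :=
  (Finset.min_mono (Finset.sdiff_subset_sdiff le_rfl hX)).trans
    (le_trans h (Finset.min_mono (Finset.sdiff_subset_sdiff hX le_rfl)))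

theorem not_lexLe_of_ssubset {X Y : Finset ℕ} (h : Y ⊂ X) : ¬ lexLe X Y := by
  intro hle
  rw [lexLe, Finset.sdiff_eq_empty_iff_subset.mpr h.subset, Finset.min_empty, top_le_iff,
    Finset.min_eq_top, Finset.sdiff_eq_empty_iff_subset] at hle
  exact h.not_subset hle

theorem lexLt_of_ssubset_of_lexLe {X X' Y : Finset ℕ} (hX : X ⊂ X') (h : lexLe X' Y) :
    lexLt X Y :=
  ⟨h.mono_left hX.subset, fun hXY => not_lexLe_of_ssubset (hXY ▸ hX) h⟩

theorem IsChainEnding.insert {P : Type*} [PartialOrder P] [DecidableEq P] {C : Finset P}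
    {x y : P} (hC : IsChainEnding C x) (hxy : x ≤ y) : IsChainEnding (insert y C) y := by
  obtain ⟨-, hle, htot⟩ := hC
  have hley : ∀ a ∈ C, a ≤ y := fun a ha => (hle a ha).trans hxy
  simp only [IsChainEnding, Finset.mem_insert]
  grind

/-- If `x < y` then `l*(x) < l*(y)` in the lexicographical order. -/
theorem grMeasure_strictMono {P : Type*} [PartialOrder P] (l : P → ℕ)
    (hl : ∀ a b : P, a < b → l a < l b) (x y : P) (hxy : x < y)
    (S T : Finset ℕ) (hS : IsGRMeasureAt l x S) (hT : IsGRMeasureAt l y T) :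
    lexLt S T := by
  classical
  obtain ⟨⟨C, hC, rfl⟩, -⟩ := hS
  have hy : l y ∉ C.image l := by
    rw [Finset.mem_image]
    rintro ⟨a, ha, hay⟩
    exact (hl a y ((hC.2.1 a ha).trans_lt hxy)).ne hay
  have hle := hT.2 _ (hC.insert hxy.le)
  rw [Finset.image_insert] at hle
  exact lexLt_of_ssubset_of_lexLe (Finset.ssubset_insert hy) hle
end

section
/- (Property GR2) Let (P, ≤) be a partially ordered set and l : P → ℕ a strictly monotone function, with Gabriel–Roiter measure l*. If x, y ∈ P satisfy l*(x) = l*(y), then l(x) = l(y). -/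
/-- The value of `l` at the endpoint of a chain is the greatest element of the image of the
chain. -/
theorem IsChainEnding.isGreatest_image {P : Type*} [PartialOrder P] {l : P → ℕ}
    (hl : StrictMono l) {C : Finset P} {x : P} (hC : IsChainEnding C x) :
    IsGreatest (C.image l : Set ℕ) (l x) := by
  rw [Finset.coe_image]
  exact hl.monotone.map_isGreatest ⟨hC.1, hC.2.1⟩

/-- (GR2) If `l*(x) = l*(y)` then `l x = l y`. -/
theorem grMeasure_GR2 {P : Type*} [PartialOrder P] (l : P → ℕ)
    (hl : ∀ a b : P, a < b → l a < l b) (x y : P)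
    (S : Finset ℕ) (hS : IsGRMeasureAt l x S) (hT : IsGRMeasureAt l y S) :
    l x = l y := by
  obtain ⟨⟨C, hC, hCS⟩, -⟩ := hS
  obtain ⟨⟨D, hD, hDS⟩, -⟩ := hT
  have hl' : StrictMono l := fun a b hab => hl a b hab
  have hx := hC.isGreatest_image hl'
  have hy := hD.isGreatest_image hl'
  rw [hCS] at hx
  rw [hDS] at hy
  exact hx.unique hy
end

section
/- Let X and Y be indecomposable finite-dimensional Λ-modules with ℓ(X) ≥ ℓ(Y). If μ(X') < μ(Y) in the lexicographical order for every indecomposable proper submodule X' of X, then μ(X) ≤ μ(Y). -/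
noncomputable section

/-- A module `M` is indecomposable if `M ≠ 0` and `M` is not the direct sum of two
nonzero submodules. -/
def IsIndecomposableModule (Λ : Type*) [Ring Λ] (M : Type*) [AddCommGroup M]
    [Module Λ M] : Prop :=
  Nontrivial M ∧ ∀ N₁ N₂ : Submodule Λ M, IsCompl N₁ N₂ → N₁ = ⊥ ∨ N₂ = ⊥

open Classical in
/-- The composition length `ℓ(M)` of a module `M`: the length of a composition series of
submodules from `⊥` to `⊤` (well defined by the Jordan–Hölder theorem; junk value `0` if
no composition series exists). -/
def compLength (Λ : Type*) [Ring Λ] (M : Type*) [AddCommGroup M] [Module Λ M] : ℕ :=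
  if h : ∃ s : CompositionSeries (Submodule Λ M), s.head = ⊥ ∧ s.last = ⊤ then
    h.choose.length else 0

/-- A Gabriel–Roiter chain ending at `M`: a finite set of submodules of `M`, totally ordered
by inclusion (hence a chain `M₁ ⊂ M₂ ⊂ ⋯ ⊂ M_t` with strict inclusions), containing
`M_t = M` itself (the top submodule), all of whose members are indecomposable. -/
def IsGRChain (Λ : Type*) [Ring Λ] {M : Type*} [AddCommGroup M] [Module Λ M]
    (C : Finset (Submodule Λ M)) : Prop :=
  (⊤ : Submodule Λ M) ∈ C ∧ (∀ N₁ ∈ C, ∀ N₂ ∈ C, N₁ ≤ N₂ ∨ N₂ ≤ N₁) ∧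
    ∀ N ∈ C, IsIndecomposableModule Λ ↥N

/-- `S` is the Gabriel–Roiter measure `μ(M)` of `M`: `S` is the set `{ℓ(M₁), …, ℓ(M_t)}`
of composition lengths along some Gabriel–Roiter chain ending at `M`, and is
lexicographically greatest among all such sets. -/
def IsGRMeasureOf (Λ : Type*) [Ring Λ] (M : Type*) [AddCommGroup M] [Module Λ M]
    (S : Finset ℕ) : Prop :=
  (∃ C : Finset (Submodule Λ M), IsGRChain Λ C ∧
      C.image (fun N : Submodule Λ M => compLength Λ ↥N) = S) ∧
  ∀ C : Finset (Submodule Λ M), IsGRChain Λ C →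
      lexLe (C.image (fun N : Submodule Λ M => compLength Λ ↥N)) S

theorem lexLe_iff {S T : Finset ℕ} :
    lexLe S T ↔ ∀ a ∈ S, a ∉ T → ∃ b ∈ T, b ∉ S ∧ b ≤ a := by
  unfold lexLe
  constructor
  · intro h a haS haT
    have hle : (T \ S).min ≤ a := h.trans (Finset.min_le (Finset.mem_sdiff.2 ⟨haS, haT⟩))
    obtain ⟨b, hb⟩ := WithTop.ne_top_iff_exists.1 (ne_top_of_le_ne_top WithTop.coe_ne_top hle)
    have hmem := Finset.mem_sdiff.1 (Finset.mem_of_min hb.symm)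
    rw [← hb] at hle
    exact ⟨b, hmem.1, hmem.2, WithTop.coe_le_coe.1 hle⟩
  · intro h
    refine Finset.le_min fun a ha => ?_
    obtain ⟨haS, haT⟩ := Finset.mem_sdiff.1 ha
    obtain ⟨b, hbT, hbS, hba⟩ := h a haS haT
    exact (Finset.min_le (Finset.mem_sdiff.2 ⟨hbT, hbS⟩)).trans (WithTop.coe_le_coe.2 hba)

/-- The colexicographic key over `ℕᵒᵈ` that represents the order `lexLe`. -/
def lexKey (S : Finset ℕ) : Colex (Finset ℕᵒᵈ) := toColex (S.map OrderDual.toDual.toEmbedding)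

theorem lexKey_le_lexKey {S T : Finset ℕ} : lexKey S ≤ lexKey T ↔ lexLe S T := by
  simp [lexLe_iff, lexKey, Finset.Colex.toColex_le_toColex, OrderDual.forall, OrderDual.exists]

theorem lexLe.trans {S T U : Finset ℕ} (h₁ : lexLe S T) (h₂ : lexLe T U) : lexLe S U :=
  lexKey_le_lexKey.1 ((lexKey_le_lexKey.2 h₁).trans (lexKey_le_lexKey.2 h₂))

theorem lexLe.antisymm {S T : Finset ℕ} (h₁ : lexLe S T) (h₂ : lexLe T S) : S = T := by
  have h := (lexKey_le_lexKey.2 h₁).antisymm (lexKey_le_lexKey.2 h₂)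
  exact Finset.map_injective _ (toColex_inj.1 h)

theorem lexLe.trans_lexLt {S T U : Finset ℕ} (h₁ : lexLe S T) (h₂ : lexLt T U) : lexLt S U :=
  ⟨h₁.trans h₂.1, fun h => h₂.2 (h₂.1.antisymm (h ▸ h₁))⟩

/-- Adjoining `n` to a set strictly below `T` stays weakly below `T` if `n` bounds both sets. -/
theorem lexLt.insert_lexLe {S T : Finset ℕ} {n : ℕ} (h : lexLt S T) (hS : ∀ a ∈ S, a ≤ n)
    (hT : ∀ a ∈ T, a ≤ n) : lexLe (insert n S) T := by
  have hST := lexLe_iff.1 h.1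
  have hex : ∃ m ∈ T, m ∉ S := by
    by_contra! hTS
    refine h.2 (Finset.Subset.antisymm (fun a ha => ?_) hTS)
    by_contra haT
    obtain ⟨b, hbT, hbS, -⟩ := hST a ha haT
    exact hbS (hTS b hbT)
  refine lexLe_iff.2 fun a ha haT => ?_
  rcases Finset.mem_insert.1 ha with rfl | haS
  · obtain ⟨m, hmT, hmS⟩ := hex
    have hma : m ≠ a := ne_of_mem_of_not_mem hmT haT
    exact ⟨m, hmT, by simp [hma, hmS], hT m hmT⟩
  · obtain ⟨b, hbT, hbS, hba⟩ := hST a haS haT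
    have hab : a ≠ b := (ne_of_mem_of_not_mem hbT haT).symm
    have hbn : b ≠ n := by have := hS a haS; omega
    exact ⟨b, hbT, by simp [hbn, hbS], hba⟩

section Length

variable {Λ : Type*} [Ring Λ] {M N : Type*} [AddCommGroup M] [Module Λ M]
  [AddCommGroup N] [Module Λ N]

theorem compLength_eq_toNat_length (Λ : Type*) [Ring Λ] (M : Type*) [AddCommGroup M]
    [Module Λ M] : compLength Λ M = (Module.length Λ M).toNat := by
  unfold compLength
  split_ifs with h
  · rw [← Module.length_compositionSeries h.choose h.choose_spec.1 h.choose_spec.2]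
    rfl
  · rw [← isFiniteLength_iff_exists_compositionSeries, ← Module.length_ne_top_iff, not_not] at h
    simp [h]

theorem LinearEquiv.compLength_eq (e : M ≃ₗ[Λ] N) : compLength Λ M = compLength Λ N := by
  rw [compLength_eq_toNat_length, compLength_eq_toNat_length, e.length_eq]

theorem compLength_submodule_le [IsNoetherian Λ M] [IsArtinian Λ M] (P : Submodule Λ M) :
    compLength Λ P ≤ compLength Λ M := by
  rw [compLength_eq_toNat_length, compLength_eq_toNat_length]
  exact ENat.toNat_le_toNat (Module.length_le_of_injective P.subtype P.injective_subtype)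
    Module.length_ne_top

theorem IsIndecomposableModule.of_linearEquiv (h : IsIndecomposableModule Λ M)
    (e : M ≃ₗ[Λ] N) : IsIndecomposableModule Λ N := by
  refine ⟨e.symm.toEquiv.nontrivial_congr.2 h.1, fun P Q hPQ => ?_⟩
  let f := Submodule.orderIsoMapComap e.symm
  refine (h.2 (f P) (f Q) (f.isCompl hPQ)).imp ?_ ?_ <;> exact (map_eq_bot_iff f).1

theorem IsIndecomposableModule.isGRChain_singleton_top (h : IsIndecomposableModule Λ M) :
    IsGRChain Λ {(⊤ : Submodule Λ M)} := by
  refine ⟨by simp, by simp, ?_⟩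
  simpa using h.of_linearEquiv Submodule.topEquiv.symm

theorem IsIndecomposableModule.exists_isGRMeasureOf [IsNoetherian Λ M] [IsArtinian Λ M]
    (h : IsIndecomposableModule Λ M) : ∃ S, IsGRMeasureOf Λ M S := by
  let A : Set (Finset ℕ) := {S | ∃ C : Finset (Submodule Λ M), IsGRChain Λ C ∧
    C.image (fun N : Submodule Λ M => compLength Λ ↥N) = S}
  have hfin : A.Finite := by
    refine (Finset.range (compLength Λ M + 1)).powerset.finite_toSet.subset ?_
    rintro _ ⟨C, -, rfl⟩
    simp only [Finset.coe_powerset, Set.mem_preimage, Set.mem_powerset_iff, Finset.coe_subset]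
    intro n hn
    obtain ⟨P, -, rfl⟩ := Finset.mem_image.1 hn
    exact Finset.mem_range_succ_iff.2 (compLength_submodule_le P)
  obtain ⟨S, hS, hmax⟩ := Set.exists_max_image A lexKey hfin
    ⟨_, _, h.isGRChain_singleton_top, rfl⟩
  exact ⟨S, hS, fun C hC => lexKey_le_lexKey.1 (hmax _ ⟨C, hC, rfl⟩)⟩

/-- A chain of indecomposable submodules with greatest member `P`, viewed inside `P`. -/
theorem exists_isGRChain_of_forall_le {C : Finset (Submodule Λ M)} {P : Submodule Λ M}
    (hP : P ∈ C) (hle : ∀ Q ∈ C, Q ≤ P) (hC : ∀ Q ∈ C, ∀ R ∈ C, Q ≤ R ∨ R ≤ Q)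
    (hind : ∀ Q ∈ C, IsIndecomposableModule Λ ↥Q) :
    ∃ D : Finset (Submodule Λ P), IsGRChain Λ D ∧
      D.image (fun N : Submodule Λ P => compLength Λ ↥N) =
        C.image (fun N : Submodule Λ M => compLength Λ ↥N) := by
  classical
  refine ⟨C.image (Submodule.comap P.subtype), ⟨?_, ?_, ?_⟩, ?_⟩
  · exact Finset.mem_image.2 ⟨P, hP, Submodule.comap_subtype_self P⟩
  · simp only [Finset.forall_mem_image]
    exact fun Q hQ R hR => (hC Q hQ R hR).imp
      (fun h => Submodule.comap_mono h) (fun h => Submodule.comap_mono h)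
  · simp only [Finset.forall_mem_image]
    exact fun Q hQ =>
      (hind Q hQ).of_linearEquiv (Submodule.comapSubtypeEquivOfLe (hle Q hQ)).symm
  · rw [Finset.image_image]
    exact Finset.image_congr fun Q hQ =>
      (Submodule.comapSubtypeEquivOfLe (hle Q hQ)).compLength_eq

/-- The set of lengths of the proper members of a Gabriel–Roiter chain, if nonempty, is at most
the measure of some proper indecomposable submodule. -/
theorem IsGRChain.erase_top_eq_empty_or_exists [DecidableEq (Submodule Λ M)]
    [IsNoetherian Λ M] [IsArtinian Λ M] {C : Finset (Submodule Λ M)} (hC : IsGRChain Λ C) :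
    C.erase ⊤ = ∅ ∨ ∃ P : Submodule Λ M, P ≠ ⊤ ∧ IsIndecomposableModule Λ P ∧
      ∃ S, IsGRMeasureOf Λ P S ∧
        lexLe ((C.erase ⊤).image (fun N : Submodule Λ M => compLength Λ ↥N)) S := by
  refine (C.erase ⊤).eq_empty_or_nonempty.imp_right fun hne => ?_
  obtain ⟨P, hP, hmax⟩ := (C.erase ⊤).exists_maximal hne
  have hPC := Finset.mem_of_mem_erase hP
  obtain ⟨D, hD, hDC⟩ := exists_isGRChain_of_forall_le hP
    (fun Q hQ => (hC.2.1 Q (Finset.mem_of_mem_erase hQ) P hPC).elim id (hmax hQ))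
    (fun Q hQ R hR => hC.2.1 Q (Finset.mem_of_mem_erase hQ) R (Finset.mem_of_mem_erase hR))
    (fun Q hQ => hC.2.2 Q (Finset.mem_of_mem_erase hQ))
  obtain ⟨S, hS⟩ := (hC.2.2 P hPC).exists_isGRMeasureOf
  exact ⟨P, Finset.ne_of_mem_erase hP, hC.2.2 P hPC, S, hS, hDC ▸ hS.2 D hD⟩

theorem IsGRMeasureOf.nonempty {S : Finset ℕ} (hS : IsGRMeasureOf Λ M S) : S.Nonempty := by
  obtain ⟨⟨C, hC, rfl⟩, -⟩ := hS
  exact ⟨_, Finset.mem_image_of_mem _ hC.1⟩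

theorem IsGRMeasureOf.le_compLength [IsNoetherian Λ M] [IsArtinian Λ M] {S : Finset ℕ}
    (hS : IsGRMeasureOf Λ M S) {n : ℕ} (hn : n ∈ S) : n ≤ compLength Λ M := by
  obtain ⟨⟨C, -, rfl⟩, -⟩ := hS
  obtain ⟨P, -, rfl⟩ := Finset.mem_image.1 hn
  exact compLength_submodule_le P

end Length

/-- Let `X`, `Y` be indecomposable finite-dimensional `Λ`-modules with `ℓ(X) ≥ ℓ(Y)`.
If `μ(X') < μ(Y)` for every indecomposable proper submodule `X'` of `X`,
then `μ(X) ≤ μ(Y)`. -/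
theorem grMeasure_GR3_module (k : Type) [Field k] (Λ : Type) [Ring Λ]
    [Algebra k Λ] [FiniteDimensional k Λ]
    (X : Type) [AddCommGroup X] [Module Λ X] [Module k X] [IsScalarTower k Λ X]
    [FiniteDimensional k X]
    (Y : Type) [AddCommGroup Y] [Module Λ Y] [Module k Y] [IsScalarTower k Λ Y]
    [FiniteDimensional k Y]
    (hX : IsIndecomposableModule Λ X) (hY : IsIndecomposableModule Λ Y)
    (hlen : compLength Λ Y ≤ compLength Λ X)
    (S T : Finset ℕ) (hS : IsGRMeasureOf Λ X S) (hT : IsGRMeasureOf Λ Y T)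
    (h : ∀ X' : Submodule Λ X, X' ≠ ⊤ → IsIndecomposableModule Λ ↥X' →
      ∀ S' : Finset ℕ, IsGRMeasureOf Λ ↥X' S' → lexLt S' T) :
    lexLe S T := by
  classical
  have : IsNoetherian Λ X := isNoetherian_of_tower k inferInstance
  have : IsArtinian Λ X := isArtinian_of_tower k inferInstance
  have : IsNoetherian Λ Y := isNoetherian_of_tower k inferInstance
  have : IsArtinian Λ Y := isArtinian_of_tower k inferInstance
  have hTX : ∀ a ∈ T, a ≤ compLength Λ X := fun a ha => (hT.le_compLength ha).trans hlen
  have hTne := hT.nonempty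
  obtain ⟨⟨C, hC, rfl⟩, -⟩ := hS
  rw [← Finset.insert_erase hC.1, Finset.image_insert,
    (Submodule.topEquiv : (⊤ : Submodule Λ X) ≃ₗ[Λ] X).compLength_eq]
  refine lexLt.insert_lexLe ?_
    (Finset.forall_mem_image.2 fun P _ => compLength_submodule_le P) hTX
  rcases hC.erase_top_eq_empty_or_exists with hempty | ⟨P, hP, hPind, S', hS', hle⟩
  · rw [hempty, Finset.image_empty]
    exact ⟨lexLe_iff.2 (by simp), hTne.ne_empty.symm⟩
  · exact hle.trans_lexLt (h P hP hPind S' hS')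
end
end

section
/- (Ext-lemma) Let X be an indecomposable finite-dimensional Λ-module, let Y, L, M be finite-dimensional Λ-modules, let n ≥ 1, and let 0 → Xⁿ ⊕ Y → L → M → 0 be a short exact sequence of Λ-modules with first map f. If dim_k Ext¹_Λ(M, X) < n, then there exists an index i with 1 ≤ i ≤ n such that the composite of the inclusion of the i-th copy of X into Xⁿ ⊕ Y with f is a split monomorphism; in particular X is a direct summand of L. -/
noncomputable section

open CategoryTheory

namespace CategoryTheory.ProjectiveResolution

open Limits

universe v u

variable {C : Type u} [Category.{v} C] [Abelian C] [EnoughProjectives C]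
  {P₁ P₀ Z : C} (d : P₁ ⟶ P₀) (π : P₀ ⟶ Z)

lemma syzygies_d_comp {A B : C} (f : A ⟶ B) : Projective.d f ≫ f = 0 :=
  (Category.assoc _ _ _).trans ((congrArg _ (kernel.condition f)).trans comp_zero)

/-- The chain complex continuing `d : P₁ ⟶ P₀` to the left by arbitrary projective syzygies. -/
def ofPresentationComplex : ChainComplex C ℕ :=
  ChainComplex.mk' P₀ P₁ d (fun f => ⟨Projective.syzygies f, Projective.d f, syzygies_d_comp f⟩)

lemma ofPresentationComplex_d_one_zero : (ofPresentationComplex d).d 1 0 = d := by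
  simp [ofPresentationComplex]

/-- The inductive step of the construction of `ofPresentationComplex`. -/
def ofPresentationComplexXIso (n : ℕ) : (ofPresentationComplex d).X (n + 2) ≅
    Projective.syzygies ((ofPresentationComplex d).d (n + 1) n) :=
  ChainComplex.mk'XIso _ _ _ _ n

lemma ofPresentationComplex_d (n : ℕ) : (ofPresentationComplex d).d (n + 2) (n + 1) =
    (ofPresentationComplexXIso d n).hom ≫
      Projective.d ((ofPresentationComplex d).d (n + 1) n) :=
  ChainComplex.mk'_d _ _ _ _ n

lemma ofPresentationComplex_exactAt_succ (n : ℕ) :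
    (ofPresentationComplex d).ExactAt (n + 1) := by
  rw [HomologicalComplex.exactAt_iff' _ (n + 2) (n + 1) n (by simp) (by simp)]
  let e : (ofPresentationComplex d).sc' (n + 2) (n + 1) n ≅ ShortComplex.mk _ _
      (syzygies_d_comp ((ofPresentationComplex d).d (n + 1) n)) :=
    ShortComplex.isoMk (ofPresentationComplexXIso d n) (Iso.refl _) (Iso.refl _)
      ((ofPresentationComplex_d d n).symm.trans (Category.comp_id _).symm)
      ((Category.id_comp _).trans (Category.comp_id _).symm)
  exact (ShortComplex.exact_iff_of_iso e).2 (exact_d_f _)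

instance [Projective P₀] [Projective P₁] (n : ℕ) :
    Projective ((ofPresentationComplex d).X n) := by
  obtain (_ | _ | n) := n
  · assumption
  · assumption
  · exact Projective.of_iso (ofPresentationComplexXIso d n).symm (Projective.projective_over _)

/-- The projective resolution of `Z` starting with a given projective presentation. -/
def ofPresentation [Projective P₀] [Projective P₁] [Epi π] (w : d ≫ π = 0)
    (h : (ShortComplex.mk d π w).Exact) : ProjectiveResolution Z where
  complex := ofPresentationComplex d
  π := (ChainComplex.toSingle₀Equiv _ _).symm ⟨π, by
          rw [ofPresentationComplex_d_one_zero]; exact w⟩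
  quasiIso := ⟨fun n => by
    cases n
    · rw [ChainComplex.quasiIsoAt₀_iff, ShortComplex.quasiIso_iff_of_zeros']
      · refine (ShortComplex.exact_and_epi_g_iff_of_iso (S₂ := ShortComplex.mk d π w) ?_).2
          ⟨h, inferInstanceAs (Epi π)⟩
        refine ShortComplex.isoMk (Iso.refl _) (Iso.refl _) (Iso.refl _) ?_ ?_
        · exact (Category.id_comp _).trans ((ofPresentationComplex_d_one_zero d).symm.trans
            (Category.comp_id _).symm)
        · exact (Category.id_comp _).trans (.trans
            (ChainComplex.toSingle₀Equiv_symm_apply_f_zero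
              (C := ofPresentationComplex d) π _).symm (Category.comp_id _).symm)
      all_goals rfl
    · rw [quasiIsoAt_iff_exactAt']
      · apply ofPresentationComplex_exactAt_succ
      · apply ChainComplex.exactAt_succ_single_obj⟩

end CategoryTheory.ProjectiveResolution

/-- If `V` has larger dimension than the homology of a short complex of `k`-modules, then any linear
map from `V` to the cycles sends some nonzero vector to a boundary. -/
lemma CategoryTheory.ShortComplex.exists_ne_zero_of_finrank_homology_lt {k : Type*} [Field k]
    (S : ShortComplex (ModuleCat k)) [Module.Finite k S.X₂] {V : Type*} [AddCommGroup V]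
    [Module k V] [Module.Finite k V] (φ : V →ₗ[k] S.X₂) (hφ : ∀ v, S.g (φ v) = 0)
    (h : Module.finrank k S.homology < Module.finrank k V) :
    ∃ v ≠ 0, ∃ x, S.f x = φ v := by
  let ψ : V →ₗ[k] (LinearMap.ker S.g.hom ⧸ LinearMap.range S.moduleCatToCycles) :=
    (Submodule.mkQ _).comp (φ.codRestrict _ hφ)
  have hker : LinearMap.ker ψ ≠ ⊥ := LinearMap.ker_ne_bot_of_finrank_lt <|
    S.moduleCatHomologyIso.toLinearEquiv.finrank_eq.symm.trans_lt h
  obtain ⟨v, hv, hv0⟩ := (Submodule.ne_bot_iff _).1 hker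
  obtain ⟨x, hx⟩ := (Submodule.Quotient.mk_eq_zero _).1 (LinearMap.mem_ker.1 hv)
  exact ⟨v, hv0, x, congrArg Subtype.val hx⟩

namespace ModuleCat

variable {k : Type} [Field k] {Λ : Type} [Ring Λ] [Algebra k Λ]

/-- Homomorphisms from a finitely generated module to a finite-dimensional one form a
finite-dimensional space. -/
lemma finite_hom (A B : ModuleCat.{0} Λ) [Module.Finite Λ A] [Module.Finite k B] :
    Module.Finite k (A ⟶ B) := by
  obtain ⟨n, p, hp⟩ := Module.Finite.exists_fin' Λ A
  let ev : (A ⟶ B) →ₗ[k] (Fin n → B) :=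
    { toFun := fun f i => f.hom (p (Pi.single i 1))
      map_add' := fun _ _ => rfl
      map_smul' := fun _ _ => rfl }
  refine Module.Finite.of_injective ev fun f g hfg => ?_
  ext x
  obtain ⟨y, rfl⟩ := hp x
  have : f.hom.comp p = g.hom.comp p := by
    refine LinearMap.pi_ext' fun i => LinearMap.ext_ring ?_
    exact congrFun hfg i
  exact LinearMap.congr_fun this y

/-- A family of cocycles on `P₁`, parametrized linearly by a space of dimension larger than that of
`Ext¹(M, X)`, contains a nonzero parameter giving a coboundary. -/
lemma exists_ne_zero_coboundary_of_finrank_ext_lt {P₁ P₀ M X : ModuleCat.{0} Λ}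
    [Projective P₀] [Projective P₁] [Module.Finite Λ P₁] [Module.Finite k X]
    (d : P₁ ⟶ P₀) (π : P₀ ⟶ M) [Epi π] (w : d ≫ π = 0) (h : (ShortComplex.mk d π w).Exact)
    {V : Type*} [AddCommGroup V] [Module k V] [Module.Finite k V]
    (φ : V →ₗ[k] (P₁ ⟶ X)) (hφ : ∀ v q, d q = 0 → φ v q = 0)
    (hV : Module.finrank k (((Ext k (ModuleCat.{0} Λ) 1).obj (Opposite.op M)).obj X) <
      Module.finrank k V) :
    ∃ v ≠ 0, ∃ e : P₀ ⟶ X, d ≫ e = φ v := by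
  let P := ProjectiveResolution.ofPresentation d π w h
  let K := P.complex.linearYonedaObj k X
  let S := K.sc' 0 1 2
  have : Module.Finite k S.X₂ := finite_hom P₁ X
  have hPd : P.complex.d 1 0 = d := ProjectiveResolution.ofPresentationComplex_d_one_zero d
  let iso : ((Ext k (ModuleCat.{0} Λ) 1).obj (Opposite.op M)).obj X ≅ S.homology :=
    P.isoExt 1 X ≪≫ ShortComplex.homologyMapIso (K.isoSc' 0 1 2 (by simp) (by simp))
  obtain ⟨v, hv, e, he⟩ := S.exists_ne_zero_of_finrank_homology_lt φ (fun v => by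
    have : P.complex.d 2 1 ≫ φ v = 0 := by
      ext x
      apply hφ v
      rw [← hPd]
      exact LinearMap.congr_fun (congrArg Hom.hom (P.complex.d_comp_d 2 1 0)) x
    exact this) (by rwa [← iso.toLinearEquiv.finrank_eq])
  refine ⟨v, hv, e, ?_⟩
  rw [← hPd]
  exact he

end ModuleCat

/-- In a short exact sequence `0 → A → L → M → 0`, a map `A → X` extends to `L` as soon as its
composite with a lift `P₁ → A` of a presentation `P₁ → P₀ → M` factors through `P₁ → P₀`. -/
lemma LinearMap.exists_comp_eq_of_presentation {R A L M X P₁ P₀ : Type*} [Ring R]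
    [AddCommGroup A] [Module R A] [AddCommGroup L] [Module R L] [AddCommGroup M] [Module R M]
    [AddCommGroup X] [Module R X] [AddCommGroup P₁] [Module R P₁] [AddCommGroup P₀] [Module R P₀]
    {f : A →ₗ[R] L} {g : L →ₗ[R] M} (hf : Function.Injective f) (hfg : Function.Exact f g)
    {d : P₁ →ₗ[R] P₀} {π : P₀ →ₗ[R] M} (hπ : Function.Surjective π) (hd : Function.Exact d π)
    {a₀ : P₀ →ₗ[R] L} {a₁ : P₁ →ₗ[R] A} (ha₀ : g.comp a₀ = π) (ha₁ : f.comp a₁ = a₀.comp d)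
    (φ : A →ₗ[R] X) (e : P₀ →ₗ[R] X) (he : e.comp d = φ.comp a₁) :
    ∃ r : L →ₗ[R] X, r.comp f = φ := by
  have hσ : Function.Surjective (a₀.coprod f) := fun l => by
    obtain ⟨p, hp⟩ := hπ (g l)
    obtain ⟨a, ha⟩ := (hfg (l - a₀ p)).1 (by
      rw [map_sub, ← hp, ← ha₀, LinearMap.comp_apply, sub_self])
    exact ⟨(p, a), by rw [LinearMap.coprod_apply, ha]; abel⟩
  have hker : LinearMap.ker (a₀.coprod f) ≤ LinearMap.ker (e.coprod φ) := by
    rintro ⟨p, a⟩ h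
    rw [LinearMap.mem_ker, LinearMap.coprod_apply] at h ⊢
    have hp : π p = 0 := by
      rw [← ha₀, LinearMap.comp_apply, eq_neg_of_add_eq_zero_left h, map_neg,
        hfg.apply_apply_eq_zero, neg_zero]
    obtain ⟨q, rfl⟩ := (hd p).1 hp
    have hq : a₁ q = -a := hf <| by
      rw [map_neg, ← eq_neg_of_add_eq_zero_left h]
      exact LinearMap.congr_fun ha₁ q
    have : e (d q) = φ (a₁ q) := LinearMap.congr_fun he q
    simp [this, hq]
  refine ⟨((LinearMap.ker _).liftQ _ hker).comp
    ((a₀.coprod f).quotKerEquivOfSurjective hσ).symm.toLinearMap, LinearMap.ext fun a => ?_⟩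
  have : ((a₀.coprod f).quotKerEquivOfSurjective hσ).symm (f a) =
      Submodule.Quotient.mk (0, a) := by
    rw [LinearEquiv.symm_apply_eq]
    simp [LinearMap.quotKerEquivOfSurjective]
  simp [this]

/-- Let `0 → A → L → M → 0` be a short exact sequence. If a space `V` of maps `A → X` has dimension
larger than `Ext¹(M, X)`, then for some nonzero `v : V` the corresponding map extends to `L`. -/
lemma LinearMap.exists_ne_zero_extension_of_finrank_ext_lt {k Λ A L M X : Type} [Field k] [Ring Λ]
    [Algebra k Λ] [IsNoetherianRing Λ] [AddCommGroup A] [Module Λ A] [AddCommGroup L] [Module Λ L]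
    [AddCommGroup M] [Module Λ M] [Module.Finite Λ M] [AddCommGroup X] [Module Λ X]
    [mX : Module k X] [IsScalarTower k Λ X] [SMulCommClass Λ k X] [fX : Module.Finite k X]
    {f : A →ₗ[Λ] L} {g : L →ₗ[Λ] M} (hf : Function.Injective f) (hg : Function.Surjective g)
    (hfg : Function.Exact f g)
    {V : Type*} [AddCommGroup V] [Module k V] [Module.Finite k V] (φ : V →ₗ[k] (A →ₗ[Λ] X))
    (hV : Module.finrank k (((Ext k (ModuleCat.{0} Λ) 1).obj
      (Opposite.op (ModuleCat.of Λ M))).obj (ModuleCat.of Λ X)) < Module.finrank k V) :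
    ∃ v ≠ 0, ∃ r : L →ₗ[Λ] X, r.comp f = φ v := by
  obtain rfl : mX = Module.restrictScalars k Λ X :=
    Module.ext' _ _ fun c x => (algebraMap_smul Λ c x).symm
  obtain ⟨m, π, hπ⟩ := Module.Finite.exists_fin' Λ M
  obtain ⟨n, q, hq⟩ := Module.Finite.exists_fin' Λ (LinearMap.ker π)
  let d := (LinearMap.ker π).subtype.comp q
  have hd : Function.Exact d π := by
    rw [LinearMap.exact_iff, LinearMap.range_comp, LinearMap.range_eq_top.2 hq]
    simp
  obtain ⟨a₀, ha₀⟩ := Module.projective_lifting_property g π hg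
  obtain ⟨a₁, ha₁⟩ := Module.projective_lifting_property f.rangeRestrict
    ((a₀.comp d).codRestrict (LinearMap.range f) fun x => (hfg _).1 <| by
      rw [← LinearMap.comp_apply, ← LinearMap.comp_assoc, ha₀]
      exact hd.apply_apply_eq_zero x) f.surjective_rangeRestrict
  replace ha₁ : f.comp a₁ = a₀.comp d :=
    LinearMap.ext fun x => congrArg Subtype.val (LinearMap.congr_fun ha₁ x)
  have : Epi (ModuleCat.ofHom π) := (ModuleCat.epi_iff_surjective _).2 hπ
  let S := ShortComplex.moduleCatMk d π hd.linearMap_comp_eq_zero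
  have hS : S.Exact := S.moduleCat_exact_iff.2 fun x hx => (hd x).1 hx
  let : Module k (ModuleCat.of Λ X) := (ModuleCat.of Λ X).moduleOfAlgebraModule
  have : Module.Finite k (ModuleCat.of Λ X) := fX
  let ψ : V →ₗ[k] (ModuleCat.of Λ (Fin n → Λ) ⟶ ModuleCat.of Λ X) :=
    { toFun := fun v => ModuleCat.ofHom ((φ v).comp a₁)
      map_add' := fun v w => by
        ext x
        simp
      map_smul' := fun c v => by
        ext x
        simp }
  have : Module.Finite Λ (ModuleCat.of Λ (Fin n → Λ)) :=
    inferInstanceAs (Module.Finite Λ (Fin n → Λ))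
  obtain ⟨v, hv, e, he⟩ := ModuleCat.exists_ne_zero_coboundary_of_finrank_ext_lt
    (ModuleCat.ofHom d) (ModuleCat.ofHom π) S.zero hS ψ (fun v x hx => by
      have : a₁ x = 0 := hf <| by
        rw [map_zero, ← LinearMap.comp_apply, ha₁, LinearMap.comp_apply]
        exact (congrArg a₀ hx).trans (map_zero a₀)
      exact (congrArg (φ v) this).trans (map_zero _)) hV
  exact ⟨v, hv, LinearMap.exists_comp_eq_of_presentation hf hfg hπ hd ha₀ ha₁ (φ v) e.hom
    (congrArg ModuleCat.Hom.hom he)⟩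

/-- (Ext-lemma) Let `X` be an indecomposable finite-dimensional `Λ`-module, `Y, L, M`
finite-dimensional `Λ`-modules, `n ≥ 1`, and `0 → Xⁿ ⊕ Y → L → M → 0` a short exact
sequence with first map `f`. If `dim_k Ext¹_Λ(M, X) < n`, then for some `i` the composite
of the inclusion of the `i`-th copy of `X` into `Xⁿ ⊕ Y` with `f` is a split monomorphism;
in particular `X` is a direct summand of `L`. -/
theorem ext_lemma (k : Type) [Field k] (Λ : Type) [Ring Λ]
    [Algebra k Λ] [FiniteDimensional k Λ]
    (X : Type) [AddCommGroup X] [Module Λ X] [Module k X] [IsScalarTower k Λ X]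
    [FiniteDimensional k X] (hX : IsIndecomposableModule Λ X)
    (Y : Type) [AddCommGroup Y] [Module Λ Y] [Module k Y] [IsScalarTower k Λ Y]
    [FiniteDimensional k Y]
    (L : Type) [AddCommGroup L] [Module Λ L] [Module k L] [IsScalarTower k Λ L]
    [FiniteDimensional k L]
    (M : Type) [AddCommGroup M] [Module Λ M] [Module k M] [IsScalarTower k Λ M]
    [FiniteDimensional k M]
    (n : ℕ) (hn : 1 ≤ n)
    (f : ((Fin n → X) × Y) →ₗ[Λ] L) (g : L →ₗ[Λ] M)
    (hf : Function.Injective f) (hg : Function.Surjective g)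
    (hexact : Function.Exact f g)
    (hext : Module.finrank k
      (((Ext k (ModuleCat.{0} Λ) 1).obj (Opposite.op (ModuleCat.of Λ M))).obj
        (ModuleCat.of Λ X)) < n) :
    (∃ (i : Fin n) (r : L →ₗ[Λ] X),
      r.comp (f.comp ((LinearMap.inl Λ (Fin n → X) Y).comp
        (LinearMap.single Λ (fun _ : Fin n => X) i))) = LinearMap.id) ∧
    ∃ N N' : Submodule Λ L, IsCompl N N' ∧ Nonempty (X ≃ₗ[Λ] ↥N) := by
  have : IsNoetherianRing Λ := isNoetherian_of_tower k inferInstance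
  have : Module.Finite Λ M := Module.Finite.of_restrictScalars_finite k Λ M
  let φ : (Fin n → k) →ₗ[k] (((Fin n → X) × Y) →ₗ[Λ] X) :=
    Fintype.linearCombination k fun i =>
      (LinearMap.proj i).comp (LinearMap.fst Λ (Fin n → X) Y)
  obtain ⟨c, hc, r, hr⟩ :=
    LinearMap.exists_ne_zero_extension_of_finrank_ext_lt hf hg hexact φ (by simpa using hext)
  obtain ⟨i, hi⟩ := Function.ne_iff.1 hc
  let ι := f.comp ((LinearMap.inl Λ (Fin n → X) Y).comp
    (LinearMap.single Λ (fun _ : Fin n => X) i))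
  have hι : ((c i)⁻¹ • r).comp ι = LinearMap.id := by
    ext x
    have : r (f (Pi.single i x, 0)) = c i • x := by
      rw [← LinearMap.comp_apply, hr]
      simp [φ, Fintype.linearCombination_apply, Pi.single_apply]
    exact (congrArg _ this).trans (inv_smul_smul₀ hi x)
  have hι_inj : Function.Injective ι :=
    Function.LeftInverse.injective (g := (c i)⁻¹ • r) fun x => LinearMap.congr_fun hι x
  refine ⟨⟨i, (c i)⁻¹ • r, hι⟩, LinearMap.range ι,
    LinearMap.ker (ι.rangeRestrict.comp ((c i)⁻¹ • r)), LinearMap.isCompl_of_proj ?_,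
    ⟨LinearEquiv.ofInjective ι hι_inj⟩⟩
  rintro ⟨_, x, rfl⟩
  exact congrArg ι.rangeRestrict (LinearMap.congr_fun hι x)
end
end

section
/- (First Brauer–Thrall conjecture) Let Λ be a finite-dimensional algebra over a field k. Then there are only finitely many isomorphism classes of indecomposable finite-dimensional Λ-modules if and only if there exists a bound b ∈ ℕ such that ℓ(M) ≤ b for every indecomposable finite-dimensional Λ-module M. -/
noncomputable section

namespace IsIndecomposableModule

section Ring

variable {Λ : Type*} [Ring Λ] {M N : Type*} [AddCommGroup M] [Module Λ M] [AddCommGroup N]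
  [Module Λ N]

/-- A split epimorphism from an indecomposable module onto a nonzero module is injective. -/
theorem bijective_of_comp_eq_id [Nontrivial N] (hM : IsIndecomposableModule Λ M)
    {g : M →ₗ[Λ] N} {s : N →ₗ[Λ] M} (h : g ∘ₗ s = LinearMap.id) : Function.Bijective g := by
  have hgs : ∀ x, g (s x) = x := fun x => LinearMap.congr_fun h x
  refine ⟨?_, fun x => ⟨s x, hgs x⟩⟩
  have hc : IsCompl (LinearMap.range s) (LinearMap.ker g) := by
    refine IsCompl.of_eq (eq_bot_iff.2 ?_) (eq_top_iff.2 fun x _ => ?_)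
    · rintro _ ⟨⟨y, rfl⟩, hy⟩
      have : y = 0 := by rw [← hgs y]; exact hy
      simp [this]
    · refine Submodule.mem_sup.2 ⟨s (g x), ⟨_, rfl⟩, x - s (g x), ?_, by abel⟩
      simp [hgs]
  rcases hM.2 _ _ hc with h0 | h0
  · exfalso
    obtain ⟨y, hy⟩ := exists_ne (0 : N)
    apply hy
    rw [← hgs y, LinearMap.range_eq_bot.1 h0]
    simp
  · exact LinearMap.ker_eq_bot.1 h0

theorem isUnit_or_isNilpotent [IsNoetherian Λ M] [IsArtinian Λ M]
    (hM : IsIndecomposableModule Λ M) (f : Module.End Λ M) : IsUnit f ∨ IsNilpotent f := by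
  obtain ⟨n, hn, h⟩ := ((Filter.eventually_ge_atTop 1).and
    (LinearMap.eventually_isCompl_ker_pow_range_pow f)).exists
  rcases hM.2 _ _ h with h0 | h0
  · left
    have hinj : Function.Injective f := by
      have := LinearMap.ker_eq_bot.1 h0
      obtain ⟨m, rfl⟩ : ∃ m, n = m + 1 := ⟨n - 1, by omega⟩
      rw [pow_succ] at this
      exact Function.Injective.of_comp (f := ⇑(f ^ m)) this
    rw [Module.End.isUnit_iff]
    exact ⟨hinj, IsArtinian.surjective_of_injective_endomorphism f hinj⟩
  · right
    exact ⟨n, LinearMap.range_eq_bot.1 h0⟩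

theorem not_isUnit_add [IsNoetherian Λ M] [IsArtinian Λ M] (hM : IsIndecomposableModule Λ M)
    {a b : Module.End Λ M} (ha : ¬IsUnit a) (hb : ¬IsUnit b) : ¬IsUnit (a + b) := by
  rintro ⟨u, hu⟩
  have key : ∀ c : Module.End Λ M, ¬IsUnit c → IsNilpotent ((↑u⁻¹ : Module.End Λ M) * c) := by
    intro c hc
    refine (hM.isUnit_or_isNilpotent _).resolve_left fun h => hc ?_
    simpa using u.isUnit.mul h
  have h1 : (↑u⁻¹ : Module.End Λ M) * b = 1 - ↑u⁻¹ * a := by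
    rw [eq_sub_iff_add_eq', ← mul_add, ← hu, Units.inv_mul]
  have h2 := (key a ha).isUnit_one_sub
  rw [← h1] at h2
  exact hb (by simpa using u.isUnit.mul h2)

end Ring

end IsIndecomposableModule

/-- An artinian module is a finite direct sum of indecomposable submodules: the identity
is a finite sum of projections onto indecomposable submodules. -/
theorem exists_indecomposable_submodules_sum_eq (Λ E : Type*) [Ring Λ] [AddCommGroup E]
    [Module Λ E] [IsArtinian Λ E] :
    ∃ (ι : Type) (_ : Fintype ι) (V : ι → Submodule Λ E) (p : ∀ i, E →ₗ[Λ] V i),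
      (∀ i, IsIndecomposableModule Λ (V i)) ∧ ∀ x, ∑ i, (p i x : E) = x := by
  suffices H : ∀ N : Submodule Λ E, ∃ (ι : Type) (_ : Fintype ι) (V : ι → Submodule Λ E)
      (p : ∀ i, N →ₗ[Λ] V i), (∀ i, IsIndecomposableModule Λ (V i)) ∧
        ∀ x, ∑ i, (p i x : E) = x by
    obtain ⟨ι, _, V, p, hV, hp⟩ := H ⊤
    exact ⟨ι, inferInstance, V, fun i => p i ∘ₗ Submodule.topEquiv.symm.toLinearMap, hV,
      fun x => hp ⟨x, trivial⟩⟩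
  intro N
  induction N using WellFoundedLT.induction with
  | _ N ih =>
  by_cases hN : IsIndecomposableModule Λ N
  · exact ⟨Unit, inferInstance, fun _ => N, fun _ => LinearMap.id, fun _ => hN, by simp⟩
  rcases subsingleton_or_nontrivial N with h0 | h0
  · exact ⟨Empty, inferInstance, fun i => i.elim, fun i => i.elim, fun i => i.elim, fun x => by
      simp [Subsingleton.elim x 0]⟩
  have : ∃ N₁ N₂ : Submodule Λ N, IsCompl N₁ N₂ ∧ N₁ ≠ ⊥ ∧ N₂ ≠ ⊥ := by
    by_contra! h
    exact hN ⟨h0, fun N₁ N₂ hc => or_iff_not_imp_left.2 (h N₁ N₂ hc)⟩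
  obtain ⟨N₁, N₂, hc, h₁, h₂⟩ := this
  have hlt : ∀ A B : Submodule Λ N, IsCompl A B → B ≠ ⊥ → A.map N.subtype < N := by
    intro A B hAB hB
    refine lt_of_le_of_ne (Submodule.map_subtype_le N A) fun h => hB ?_
    have : A = ⊤ := by
      apply Submodule.map_injective_of_injective N.injective_subtype
      rw [h, Submodule.map_subtype_top]
    simpa [this] using hAB.inf_eq_bot
  obtain ⟨ι₁, _, V₁, p₁, hV₁, hp₁⟩ := ih _ (hlt N₁ N₂ hc h₂)
  obtain ⟨ι₂, _, V₂, p₂, hV₂, hp₂⟩ := ih _ (hlt N₂ N₁ hc.symm h₁)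
  let q (A B : Submodule Λ N) (h : IsCompl A B) : N →ₗ[Λ] A.map N.subtype :=
    (Submodule.equivMapOfInjective N.subtype N.injective_subtype A).toLinearMap ∘ₗ
      A.projectionOnto B h
  refine ⟨ι₁ ⊕ ι₂, inferInstance, Sum.elim V₁ V₂,
    fun i => match i with
      | .inl i => p₁ i ∘ₗ q N₁ N₂ hc
      | .inr i => p₂ i ∘ₗ q N₂ N₁ hc.symm,
    fun i => match i with
      | .inl i => hV₁ i
      | .inr i => hV₂ i, fun x => ?_⟩
  rw [Fintype.sum_sum_type]
  have e₁ := hp₁ (q N₁ N₂ hc x)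
  have e₂ := hp₂ (q N₂ N₁ hc.symm x)
  have e₃ : ((q N₁ N₂ hc x : E)) + (q N₂ N₁ hc.symm x : E) = x := by
    have := Submodule.projection_add_projection_eq_self hc x
    exact congrArg (Subtype.val) this
  rw [← e₃]
  exact congrArg₂ (· + ·) e₁ e₂

section HaradaSai

/-- A homomorphism `M → C` that is a composition of a homomorphism `M → Pₙ` followed by `n`
non-isomorphisms `Pₙ → ⋯ → P₁ → C` with all `Pᵢ` finitely generated indecomposable. -/
def IsRadicalChain {Λ : Type*} [Ring Λ] {M : Type*} [AddCommGroup M] [Module Λ M] :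
    ℕ → (C : ModuleCat.{0} Λ) → (M →ₗ[Λ] C) → Prop
  | 0, _, _ => True
  | n + 1, C, f => ∃ (P : ModuleCat.{0} Λ) (g : M →ₗ[Λ] P) (h : P →ₗ[Λ] C),
      Module.Finite Λ P ∧ IsIndecomposableModule Λ P ∧ IsRadicalChain n P g ∧
        ¬Function.Bijective h ∧ f = h ∘ₗ g

variable {Λ : Type*} [Ring Λ] {M : Type} [AddCommGroup M] [Module Λ M]

theorem IsRadicalChain.exists_comp {m n : ℕ} {C : ModuleCat.{0} Λ} (hfin : Module.Finite Λ C)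
    (hC : IsIndecomposableModule Λ C) {f : M →ₗ[Λ] C} (hf : IsRadicalChain (n + m) C f) :
    ∃ (P : ModuleCat.{0} Λ) (g : M →ₗ[Λ] P) (h : P →ₗ[Λ] C), Module.Finite Λ P ∧
      IsIndecomposableModule Λ P ∧ IsRadicalChain n P g ∧ IsRadicalChain m C h ∧
        f = h ∘ₗ g := by
  induction m generalizing C with
  | zero => exact ⟨C, f, LinearMap.id, hfin, hC, hf, trivial, rfl⟩
  | succ m ih =>
    obtain ⟨P, g, h, hP, hP', hg, hh, rfl⟩ := hf
    obtain ⟨Q, a, c, hQ, hQ', ha, hc, rfl⟩ := ih hP hP' hg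
    exact ⟨Q, a, h ∘ₗ c, hQ, hQ', ha, ⟨P, c, h, hP, hP', hc, hh, rfl⟩, rfl⟩

/-- If a composition `M → P → Q → C` with `P`, `Q` indecomposable is nonzero, and neither
`M → P` nor `Q → C` loses length in the composition, then `P → Q` is bijective. -/
theorem bijective_of_range_eq_of_ker_eq {P Q C : Type*} [AddCommGroup P] [Module Λ P]
    [AddCommGroup Q] [Module Λ Q] [AddCommGroup C] [Module Λ C]
    (hP : IsIndecomposableModule Λ P) (hQ : IsIndecomposableModule Λ Q)
    {g : M →ₗ[Λ] P} {u : P →ₗ[Λ] Q} {h : Q →ₗ[Λ] C} (h0 : h ∘ₗ u ∘ₗ g ≠ 0)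
    (hr : LinearMap.range (h ∘ₗ u ∘ₗ g) = LinearMap.range h)
    (hk : LinearMap.ker (h ∘ₗ u ∘ₗ g) = LinearMap.ker g) : Function.Bijective u := by
  have hk' : ∀ x, h (u (g x)) = 0 → g x = 0 := fun x hx => by
    have : x ∈ LinearMap.ker (h ∘ₗ u ∘ₗ g) := hx
    rwa [hk] at this
  have hQc : IsCompl (LinearMap.range (u ∘ₗ g)) (LinearMap.ker h) := by
    refine IsCompl.of_eq (eq_bot_iff.2 ?_) (eq_top_iff.2 fun y _ => ?_)
    · rintro _ ⟨⟨x, rfl⟩, hx⟩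
      simp [hk' x hx]
    · have : h y ∈ LinearMap.range (h ∘ₗ u ∘ₗ g) := hr ▸ ⟨y, rfl⟩
      obtain ⟨x, hx⟩ := this
      refine Submodule.mem_sup.2 ⟨u (g x), ⟨x, rfl⟩, y - u (g x), ?_, by abel⟩
      simp only [LinearMap.comp_apply] at hx
      simp [hx]
  rcases hQ.2 _ _ hQc with hb | hb
  · exact absurd (by rw [LinearMap.range_eq_bot.1 hb, LinearMap.comp_zero]) h0
  have hsurj : ∀ y, ∃ x, u (g x) = y := by
    rw [hb] at hQc
    have := hQc.sup_eq_top
    rw [sup_bot_eq] at this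
    exact LinearMap.range_eq_top.1 this
  have hPc : IsCompl (LinearMap.range g) (LinearMap.ker u) := by
    refine IsCompl.of_eq (eq_bot_iff.2 ?_) (eq_top_iff.2 fun y _ => ?_)
    · rintro _ ⟨⟨x, rfl⟩, hx⟩
      exact hk' x (by rw [LinearMap.mem_ker.1 hx, map_zero])
    · obtain ⟨x, hx⟩ := hsurj (u y)
      exact Submodule.mem_sup.2 ⟨g x, ⟨x, rfl⟩, y - g x, by simp [hx], by abel⟩
  rcases hP.2 _ _ hPc with hc | hc
  · exact absurd (by rw [LinearMap.range_eq_bot.1 hc, LinearMap.comp_zero,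
      LinearMap.comp_zero]) h0
  · exact ⟨LinearMap.ker_eq_bot.1 hc, fun y => (hsurj y).imp' g fun _ h => h⟩

theorem LinearMap.length_eq_length_ker_add_length_range {M N : Type*} [AddCommGroup M] [Module Λ M]
    [AddCommGroup N] [Module Λ N] (f : M →ₗ[Λ] N) :
    Module.length Λ M = Module.length Λ (LinearMap.ker f) + Module.length Λ (LinearMap.range f) :=
  Module.length_eq_add_of_exact (LinearMap.ker f).subtype f.rangeRestrict
    (Submodule.injective_subtype _) f.surjective_rangeRestrict
    (LinearMap.exact_iff.2 (by simp))

theorem Submodule.eq_of_le_of_length_le [IsNoetherian Λ M] [IsArtinian Λ M]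
    {A B : Submodule Λ M} (hAB : A ≤ B) (h : Module.length Λ B ≤ Module.length Λ A) : A = B := by
  by_contra hne
  have := Submodule.height_strictMono (lt_of_le_of_ne hAB hne)
  rw [Module.length_submodule, Module.length_submodule] at h
  exact absurd h (not_le.2 this)

/-- The number `2 ^ n - 1` from the Harada–Sai lemma. -/
def haradaSaiBound : ℕ → ℕ
  | 0 => 0
  | n + 1 => haradaSaiBound n + (haradaSaiBound n + 1)

/-- The Harada–Sai lemma: if finitely generated indecomposable modules have length at most `b`,
then the image of a nonzero composition of `2 ^ n - 1` non-isomorphisms between indecomposable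
modules has length at most `b - n`. -/
theorem IsRadicalChain.length_range_add_le [IsArtinianRing Λ] {b : ℕ}
    (hb : ∀ C : ModuleCat.{0} Λ, Module.Finite Λ C → IsIndecomposableModule Λ C →
      Module.length Λ C ≤ b) (n : ℕ) {M : Type} [AddCommGroup M] [Module Λ M] [Module.Finite Λ M]
    {C : ModuleCat.{0} Λ}
    (hfin : Module.Finite Λ C) (hC : IsIndecomposableModule Λ C) {f : M →ₗ[Λ] C}
    (hf : IsRadicalChain (haradaSaiBound n) C f) (h0 : f ≠ 0) :
    Module.length Λ (LinearMap.range f) + n ≤ b := by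
  induction n generalizing M C with
  | zero =>
    simpa using (Module.length_le_of_injective _ (Submodule.injective_subtype _)).trans
      (hb C hfin hC)
  | succ n ih =>
    obtain ⟨Q, g', h, hQ, hQ', hg', hh, rfl⟩ :=
      IsRadicalChain.exists_comp (n := haradaSaiBound n + 1) hfin hC
        (by rw [add_comm]; exact hf)
    obtain ⟨P, g, u, hP, hP', hg, hu, rfl⟩ := hg'
    have hg0 : g ≠ 0 := by rintro rfl; simp at h0
    have hh0 : h ≠ 0 := by rintro rfl; simp at h0
    have ihg := ih hP hP' hg hg0
    have ihh := ih hfin hC hh hh0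
    set f := h ∘ₗ u ∘ₗ g with hfdef
    by_contra hlt
    have hfin' : Module.length Λ (LinearMap.range f) ≠ ⊤ := Module.length_ne_top
    have key : ∀ L : ℕ∞, L + n ≤ b → L ≤ Module.length Λ (LinearMap.range f) := by
      intro L hL
      generalize Module.length Λ (LinearMap.range f) = R at *
      lift R to ℕ using hfin'
      have hLt : L ≠ ⊤ := by rintro rfl; simp at hL
      lift L to ℕ using hLt
      norm_cast at *
      omega
    refine hu (bijective_of_range_eq_of_ker_eq hP' hQ' h0 ?_ ?_)
    · exact Submodule.eq_of_le_of_length_le (LinearMap.range_comp_le_range _ _) (key _ ihh)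
    · refine (Submodule.eq_of_le_of_length_le ?_ ?_).symm
      · exact (LinearMap.ker_le_ker_comp g (h ∘ₗ u))
      · have e1 := LinearMap.length_eq_length_ker_add_length_range g
        have e2 := LinearMap.length_eq_length_ker_add_length_range f
        have h1 := key _ ihg
        have t1 : Module.length Λ (LinearMap.ker g) ≠ ⊤ := Module.length_ne_top
        have t2 : Module.length Λ (LinearMap.ker f) ≠ ⊤ := Module.length_ne_top
        have t3 : Module.length Λ (LinearMap.range g) ≠ ⊤ := Module.length_ne_top
        rw [e1] at e2
        change Module.length Λ (LinearMap.ker f) ≤ _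
        generalize Module.length Λ (LinearMap.ker g) = a1 at *
        generalize Module.length Λ (LinearMap.ker f) = a2 at *
        generalize Module.length Λ (LinearMap.range g) = a3 at *
        generalize Module.length Λ (LinearMap.range f) = a4 at *
        lift a1 to ℕ using t1
        lift a2 to ℕ using t2
        lift a3 to ℕ using t3
        lift a4 to ℕ using hfin'
        norm_cast at *
        omega

end HaradaSai

/-- The dual `Hom_k(Λ, k)` of a `k`-algebra `Λ`, regarded as a left `Λ`-module through right
multiplication on `Λ`. -/
def DualRegular (k Λ : Type*) [Field k] [Ring Λ] [Algebra k Λ] := Module.Dual k Λ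

namespace DualRegular

variable {k Λ : Type*} [Field k] [Ring Λ] [Algebra k Λ]

instance : AddCommGroup (DualRegular k Λ) := inferInstanceAs (AddCommGroup (Module.Dual k Λ))

instance : Module k (DualRegular k Λ) := inferInstanceAs (Module k (Module.Dual k Λ))

instance : FunLike (DualRegular k Λ) Λ k := inferInstanceAs (FunLike (Module.Dual k Λ) Λ k)

instance : LinearMapClass (DualRegular k Λ) k Λ k :=
  inferInstanceAs (LinearMapClass (Module.Dual k Λ) k Λ k)

instance : SMul Λ (DualRegular k Λ) where
  smul a f := LinearMap.comp (show Module.Dual k Λ from f) (LinearMap.mulRight k a)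

@[simp] theorem smul_apply (a x : Λ) (f : DualRegular k Λ) : (a • f) x = f (x * a) := rfl

@[simp] theorem add_apply (x : Λ) (f g : DualRegular k Λ) : (f + g) x = f x + g x := rfl

@[simp] theorem zero_apply (x : Λ) : (0 : DualRegular k Λ) x = 0 := rfl

@[simp] theorem field_smul_apply (c : k) (x : Λ) (f : DualRegular k Λ) :
    (c • f) x = c • f x := rfl

@[ext] theorem ext {f g : DualRegular k Λ} (h : ∀ x, f x = g x) : f = g := DFunLike.ext _ _ h

instance : Module Λ (DualRegular k Λ) where
  one_smul f := by ext; simp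
  mul_smul a b f := by ext; simp [mul_assoc]
  smul_zero a := by ext; simp
  smul_add a f g := by ext; simp
  add_smul a b f := by ext; simp [mul_add]
  zero_smul f := by ext; simp

instance : IsScalarTower k Λ (DualRegular k Λ) where
  smul_assoc c a f := by ext; simp

instance [FiniteDimensional k Λ] : Module.Finite Λ (DualRegular k Λ) :=
  have : Module.Finite k (DualRegular k Λ) := inferInstanceAs (Module.Finite k (Module.Dual k Λ))
  Module.Finite.of_restrictScalars_finite k Λ _

/-- The `Λ`-linear map into `DualRegular k Λ` corresponding to a `k`-linear functional. -/
def ofFunctional {X : Type*} [AddCommGroup X] [Module Λ X] [Module k X] [IsScalarTower k Λ X]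
    (φ : Module.Dual k X) : X →ₗ[Λ] DualRegular k Λ where
  toFun x := φ ∘ₗ (LinearMap.toSpanSingleton Λ X x).restrictScalars k
  map_add' x y := DualRegular.ext fun a => by
    change φ (a • (x + y)) = φ (a • x) + φ (a • y)
    simp
  map_smul' b x := DualRegular.ext fun a => by
    change φ (a • b • x) = φ ((a * b) • x)
    rw [mul_smul]

@[simp] theorem ofFunctional_apply {X : Type*} [AddCommGroup X] [Module Λ X] [Module k X]
    [IsScalarTower k Λ X] (φ : Module.Dual k X) (x : X) (a : Λ) :
    ofFunctional (Λ := Λ) φ x a = φ (a • x) := rfl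

end DualRegular

theorem isScalarTower_compHom (k Λ M : Type*) [Field k] [Ring Λ] [Algebra k Λ] [AddCommGroup M]
    [Module Λ M] : letI := Module.compHom M (algebraMap k Λ); IsScalarTower k Λ M :=
  letI := Module.compHom M (algebraMap k Λ)
  ⟨fun a b x => by rw [Algebra.smul_def, mul_smul]; rfl⟩

/-- A functional on tuples which separates the non-units of the endomorphism ring of an
indecomposable module from the identity. -/
theorem IsIndecomposableModule.exists_functional {k Λ C ι : Type*} [Field k] [Ring Λ]
    [Algebra k Λ] [AddCommGroup C]
    [Module Λ C] [Module k C] [IsScalarTower k Λ C] [IsNoetherian Λ C] [IsArtinian Λ C]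
    (hC : IsIndecomposableModule Λ C) (c : ι → C) (hc : Submodule.span Λ (Set.range c) = ⊤) :
    ∃ φ : Module.Dual k (ι → C), (∀ u : Module.End Λ C, ¬IsUnit u → φ (fun i => u (c i)) = 0) ∧
      φ c ≠ 0 := by
  have := hC.1
  let J : Submodule k (ι → C) :=
    { carrier := {x | ∃ u : Module.End Λ C, ¬IsUnit u ∧ x = fun i => u (c i)}
      add_mem' := by
        rintro _ _ ⟨u, hu, rfl⟩ ⟨v, hv, rfl⟩
        exact ⟨u + v, hC.not_isUnit_add hu hv, rfl⟩
      zero_mem' := ⟨0, not_isUnit_zero, rfl⟩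
      smul_mem' := by
        rintro t _ ⟨u, hu, rfl⟩
        rcases eq_or_ne t 0 with rfl | ht
        · exact ⟨0, not_isUnit_zero, by ext; simp⟩
        have : SMulCommClass Λ k C := IsScalarTower.to_smulCommClass'
        refine ⟨t • u, fun h => hu ?_, rfl⟩
        have := h.smul (Units.mk0 t ht)⁻¹
        simpa [Units.smul_def, smul_smul, ht] using this }
  have hcJ : c ∉ J := by
    rintro ⟨u, hu, h⟩
    have : u = LinearMap.id := by
      refine (LinearMap.ext_on_range hc fun i => ?_)
      exact (congrFun h i).symm
    exact hu (this ▸ isUnit_one)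
  obtain ⟨φ, h1, h2⟩ := J.exists_dual_map_eq_bot_of_notMem hcJ inferInstance
  refine ⟨φ, fun u hu => ?_, h1⟩
  have : φ (fun i => u (c i)) ∈ J.map φ := ⟨_, ⟨u, hu, rfl⟩, rfl⟩
  rwa [h2] at this

/-- Existence of right almost split homomorphisms in the category of finitely generated modules:
for each indecomposable `C` there is a homomorphism `E → C` which is not a split epimorphism and
through which each homomorphism `X → C` that is not a split epimorphism factors. -/
theorem IsIndecomposableModule.exists_rightAlmostSplit (k : Type) {Λ : Type} [Field k] [Ring Λ]
    [Algebra k Λ] [FiniteDimensional k Λ] {C : Type} [AddCommGroup C]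
    [Module Λ C] [Module.Finite Λ C] (hC : IsIndecomposableModule Λ C) :
    ∃ (E : ModuleCat.{0} Λ) (e : E →ₗ[Λ] C), Module.Finite Λ E ∧
      (¬∃ s : C →ₗ[Λ] E, e ∘ₗ s = LinearMap.id) ∧
      ∀ (X : Type) [AddCommGroup X] [Module Λ X] (g : X →ₗ[Λ] C),
        (¬∃ s : C →ₗ[Λ] X, g ∘ₗ s = LinearMap.id) → ∃ g' : X →ₗ[Λ] E, e ∘ₗ g' = g := by
  have : IsArtinianRing Λ := IsArtinianRing.of_finite k Λ
  let _ : Module k C := Module.compHom C (algebraMap k Λ)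
  have := isScalarTower_compHom k Λ C
  obtain ⟨n, p, hp⟩ := Module.Finite.exists_fin' Λ C
  obtain ⟨m, r, hr⟩ := Submodule.fg_iff_exists_fin_generating_family.1
    (IsNoetherian.noetherian (LinearMap.ker p))
  set c : Fin n → C := fun i => p (Pi.single i 1) with hcdef
  have hpc : ∀ a, p a = ∑ i, a i • c i := fun a => by
    conv_lhs => rw [← Finset.univ_sum_single a, map_sum]
    refine Finset.sum_congr rfl fun i _ => ?_
    rw [hcdef, ← map_smul, ← Pi.single_smul, smul_eq_mul, mul_one]
  have hc : Submodule.span Λ (Set.range c) = ⊤ := by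
    refine eq_top_iff.2 fun x _ => ?_
    obtain ⟨a, rfl⟩ := hp x
    rw [hpc]
    exact Submodule.sum_mem _ fun i _ => Submodule.smul_mem _ _ (Submodule.subset_span ⟨i, rfl⟩)
  have hrc : ∀ j, ∑ i, r j i • c i = 0 := fun j => by
    rw [← hpc]
    have : r j ∈ LinearMap.ker p := hr ▸ Submodule.subset_span ⟨j, rfl⟩
    exact this
  obtain ⟨φ, hφ, hφc⟩ := hC.exists_functional (k := k) c hc
  let E : Submodule Λ (C × (Fin m → DualRegular k Λ)) :=
    { carrier := {y | ∀ i a, φ (Pi.single i (a • y.1)) = ∑ j, y.2 j (r j i * a)}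
      add_mem' := by
        intro y z hy hz i a
        simp only [Prod.fst_add, Prod.snd_add, Pi.add_apply, DualRegular.add_apply, smul_add,
          Pi.single_add, map_add, Finset.sum_add_distrib]
        rw [hy, hz]
      zero_mem' := by intro i a; simp
      smul_mem' := by
        intro b y hy i a
        simp only [Prod.smul_fst, Prod.smul_snd, Pi.smul_apply, DualRegular.smul_apply, smul_smul,
          hy i (a * b), mul_assoc] }
  refine ⟨ModuleCat.of Λ E, LinearMap.fst Λ _ _ ∘ₗ E.subtype,
    inferInstanceAs (Module.Finite Λ E), ?_, ?_⟩
  · rintro ⟨s, hs⟩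
    apply hφc
    let w : Fin m → C →ₗ[Λ] DualRegular k Λ := fun j =>
      LinearMap.proj j ∘ₗ LinearMap.snd Λ _ _ ∘ₗ E.subtype ∘ₗ s
    have hs1 : ∀ x, ((s x : E) : C × (Fin m → DualRegular k Λ)).1 = x :=
      fun x => LinearMap.congr_fun hs x
    have hw : ∀ i x, φ (Pi.single i x) = ∑ j, (r j i • w j x) 1 := by
      intro i x
      have := (s x : E).2 i 1
      rw [hs1, one_smul] at this
      rw [this]
      simp [w]
    rw [← Finset.univ_sum_single c, map_sum]
    simp only [hw]
    rw [Finset.sum_comm]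
    refine Finset.sum_eq_zero fun j _ => ?_
    have h1 : ∀ (s : Finset (Fin n)) (F : Fin n → DualRegular k Λ),
        ∑ i ∈ s, (F i) 1 = (∑ i ∈ s, F i) 1 := fun s F =>
      (map_sum (LinearMap.applyₗ (R := k) (M := Λ) (M₂ := k) (1 : Λ)) F s).symm
    rw [h1]
    simp only [← map_smul, ← map_sum, hrc, map_zero, DualRegular.zero_apply]
  · intro X _ _ g hg
    let _ : Module k X := Module.compHom X (algebraMap k Λ)
    have := isScalarTower_compHom k Λ X
    let R : (Fin n → X) →ₗ[k] (Fin m → X) :=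
      LinearMap.pi fun j => ∑ i, (Algebra.lsmul k k X (r j i)) ∘ₗ LinearMap.proj i
    have hR : ∀ x j, R x j = ∑ i, r j i • x i := fun x j => by
      simp [R]
    let ℓ : Module.Dual k (Fin n → X) := φ ∘ₗ (g.restrictScalars k).compLeft (Fin n)
    have hℓ : ∀ x, ℓ x = φ (fun i => g (x i)) := fun x => rfl
    have hker : ℓ ∈ (LinearMap.ker R).dualAnnihilator := by
      rw [Submodule.mem_dualAnnihilator]
      intro x hx
      have hx' : ∀ j, ∑ i, r j i • x i = 0 := fun j => by
        rw [← hR, LinearMap.mem_ker.1 hx, Pi.zero_apply]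
      have hle : LinearMap.ker p ≤ LinearMap.ker (Fintype.linearCombination Λ x) := by
        rw [← hr, Submodule.span_le]
        rintro _ ⟨j, rfl⟩
        simpa [Fintype.linearCombination_apply] using hx' j
      let h : C →ₗ[Λ] X := (LinearMap.ker p).liftQ _ hle ∘ₗ
        (p.quotKerEquivOfSurjective hp).symm.toLinearMap
      have hh : ∀ i, h (c i) = x i := fun i => by
        have : (p.quotKerEquivOfSurjective hp).symm (c i) =
            (LinearMap.ker p).mkQ (Pi.single i 1) := by
          rw [LinearEquiv.symm_apply_eq]
          rfl
        simp [h, this]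
      rw [hℓ]
      simp only [← hh]
      refine hφ (g ∘ₗ h) fun hu => hg ?_
      obtain ⟨v, hv⟩ := hu.exists_right_inv
      exact ⟨h ∘ₗ v, hv⟩
    rw [← LinearMap.range_dualMap_eq_dualAnnihilator_ker] at hker
    obtain ⟨ψ, hψ⟩ := hker
    have hψ' : ∀ x, φ (fun i => g (x i)) = ψ (R x) := fun x => by rw [← hℓ, ← hψ]; rfl
    let w : X →ₗ[Λ] (Fin m → DualRegular k Λ) := LinearMap.pi fun j =>
      DualRegular.ofFunctional (ψ ∘ₗ LinearMap.single k (fun _ => X) j)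
    refine ⟨(g.prod w).codRestrict E fun x i a => ?_, rfl⟩
    have h1 : (Pi.single i (a • g x) : Fin n → C) =
        fun i' => g ((Pi.single i (a • x) : Fin n → X) i') := by
      ext i'
      rcases eq_or_ne i' i with rfl | hne
      · simp
      · simp [hne]
    have h2 : R (Pi.single i (a • x)) = ∑ j, Pi.single j ((r j i * a) • x) := by
      rw [Finset.univ_sum_single]
      ext j
      rw [hR, Finset.sum_eq_single i]
      · simp [mul_smul]
      · intro b _ hb
        simp [hb]
      · simp
    change φ (Pi.single i (a • g x)) = ∑ j, ψ (Pi.single j ((r j i * a) • x))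
    rw [h1, hψ', h2, map_sum]

/-- For `M` outside finitely many isomorphism classes of indecomposable modules, a homomorphism
from `C` that vanishes on all compositions `M → Pₙ → ⋯ → P₁ → C` ending in `n` non-isomorphisms
vanishes on all homomorphisms `M → C`. -/
theorem IsIndecomposableModule.exists_finite_radicalChain (k : Type) {Λ : Type} [Field k]
    [Ring Λ] [Algebra k Λ] [FiniteDimensional k Λ] (n : ℕ) (C : ModuleCat.{0} Λ)
    (hfin : Module.Finite Λ C) (hC : IsIndecomposableModule Λ C) :
    ∃ T : Set (ModuleCat.{0} Λ), T.Finite ∧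
      ∀ (M : Type) [AddCommGroup M] [Module Λ M], IsIndecomposableModule Λ M →
        (∀ V ∈ T, ¬Nonempty (M ≃ₗ[Λ] V)) → ∀ (Z : Type) [AddCommGroup Z] [Module Λ Z]
          (e : C →ₗ[Λ] Z) (f : M →ₗ[Λ] C), e ∘ₗ f ≠ 0 →
            ∃ g : M →ₗ[Λ] C, IsRadicalChain n C g ∧ e ∘ₗ g ≠ 0 := by
  have : IsArtinianRing Λ := IsArtinianRing.of_finite k Λ
  induction n generalizing C with
  | zero => exact ⟨∅, Set.finite_empty, fun M _ _ _ _ Z _ _ e f h => ⟨f, trivial, h⟩⟩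
  | succ n ih =>
    obtain ⟨E, π, hE, hπ, hfac⟩ := hC.exists_rightAlmostSplit k
    obtain ⟨ι, _, V, p, hV, hp⟩ := exists_indecomposable_submodules_sum_eq Λ E
    choose T hT hTM using fun i => ih (ModuleCat.of Λ (V i))
      (inferInstanceAs (Module.Finite Λ (V i))) (hV i)
    refine ⟨{C} ∪ ⋃ i, T i, (Set.finite_singleton C).union (Set.finite_iUnion hT), ?_⟩
    intro M _ _ hM hMT Z _ _ e f hef
    have := hC.1
    obtain ⟨f', rfl⟩ := hfac M f fun ⟨s, hs⟩ => hMT C (by simp)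
      ⟨LinearEquiv.ofBijective f (hM.bijective_of_comp_eq_id hs)⟩
    have : ∃ i, (e ∘ₗ π ∘ₗ (V i).subtype) ∘ₗ (p i ∘ₗ f') ≠ 0 := by
      by_contra! h
      refine hef (LinearMap.ext fun x => ?_)
      have h1 : ∀ i, e (π (p i (f' x))) = 0 := fun i => LinearMap.congr_fun (h i) x
      simp only [LinearMap.comp_apply, LinearMap.zero_apply]
      rw [← hp (f' x), map_sum, map_sum]
      exact Finset.sum_eq_zero fun i _ => h1 i
    obtain ⟨i, hi⟩ := this
    obtain ⟨g, hg, hg'⟩ := hTM i M hM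
      (fun W hW => hMT W (Or.inr (Set.mem_iUnion.2 ⟨i, hW⟩))) Z _ _ hi
    refine ⟨π ∘ₗ (V i).subtype ∘ₗ g, ⟨ModuleCat.of Λ (V i), g, π ∘ₗ (V i).subtype,
      inferInstanceAs (Module.Finite Λ (V i)), hV i, hg, fun hb => hπ ?_, rfl⟩, hg'⟩
    refine ⟨(V i).subtype ∘ₗ (LinearEquiv.ofBijective _ hb).symm.toLinearMap, ?_⟩
    ext x
    exact (LinearEquiv.ofBijective (π ∘ₗ (V i).subtype) hb).apply_symm_apply x

/-- If the lengths of the finitely generated indecomposable modules are bounded, then there are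
only finitely many of them up to isomorphism. -/
theorem exists_finite_of_length_le (k : Type) {Λ : Type} [Field k] [Ring Λ] [Algebra k Λ]
    [FiniteDimensional k Λ] {b : ℕ}
    (hb : ∀ C : ModuleCat.{0} Λ, Module.Finite Λ C → IsIndecomposableModule Λ C →
      Module.length Λ C ≤ b) :
    ∃ T : Set (ModuleCat.{0} Λ), T.Finite ∧ ∀ (M : Type) [AddCommGroup M] [Module Λ M]
      [Module.Finite Λ M], IsIndecomposableModule Λ M → ∃ V ∈ T, Nonempty (M ≃ₗ[Λ] V) := by
  have : IsArtinianRing Λ := IsArtinianRing.of_finite k Λ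
  obtain ⟨ι, _, V, p, hV, hp⟩ := exists_indecomposable_submodules_sum_eq Λ (DualRegular k Λ)
  choose T hT hTM using fun i => IsIndecomposableModule.exists_finite_radicalChain k
    (haradaSaiBound b) (ModuleCat.of Λ (V i)) (inferInstanceAs (Module.Finite Λ (V i))) (hV i)
  refine ⟨⋃ i, T i, Set.finite_iUnion hT, fun M _ _ _ hM => ?_⟩
  by_contra! hMT
  have := hM.1
  let _ : Module k M := Module.compHom M (algebraMap k Λ)
  have := isScalarTower_compHom k Λ M
  obtain ⟨x, hx⟩ := exists_ne (0 : M)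
  obtain ⟨φ, hφ⟩ := (not_forall.1 fun h => hx ((Module.forall_dual_apply_eq_zero_iff k x).1 h))
  have hex : ∃ i, p i ∘ₗ DualRegular.ofFunctional (Λ := Λ) φ ≠ 0 := by
    by_contra! h
    apply hφ
    have h1 : ∀ i, p i (DualRegular.ofFunctional (Λ := Λ) φ x) = 0 :=
      fun i => LinearMap.congr_fun (h i) x
    have h2 := hp (DualRegular.ofFunctional φ x)
    simp only [h1, ZeroMemClass.coe_zero, Finset.sum_const_zero] at h2
    have h3 : DualRegular.ofFunctional (Λ := Λ) φ x 1 = 0 := by rw [← h2]; rfl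
    simpa using h3
  obtain ⟨i, hi⟩ := hex
  obtain ⟨g, hg, hg0⟩ := hTM i M hM
    (fun W hW => not_nonempty_iff.2 (hMT W (Set.mem_iUnion.2 ⟨i, hW⟩))) (V i) LinearMap.id
    (p i ∘ₗ DualRegular.ofFunctional φ) hi
  have hle := hg.length_range_add_le hb b (inferInstanceAs (Module.Finite Λ (V i))) (hV i) hg0
  have hpos : 0 < Module.length Λ (LinearMap.range g) := by
    rw [Module.length_pos_iff, Submodule.nontrivial_iff_ne_bot]
    exact fun h => hg0 (LinearMap.range_eq_bot.1 h)
  have hne : Module.length Λ (LinearMap.range g) ≠ ⊤ := by rintro h; simp [h] at hle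
  generalize Module.length Λ (LinearMap.range g) = L at *
  lift L to ℕ using hne
  norm_cast at *
  omega

theorem compLength_eq_length (Λ M : Type*) [Ring Λ] [AddCommGroup M] [Module Λ M]
    [IsNoetherian Λ M] [IsArtinian Λ M] : (compLength Λ M : ℕ∞) = Module.length Λ M := by
  have h := exists_compositionSeries_of_isNoetherian_isArtinian Λ M
  rw [compLength, dif_pos h]
  exact Module.length_compositionSeries _ h.choose_spec.1 h.choose_spec.2

/-- (First Brauer–Thrall conjecture) There are only finitely many isomorphism classes of
indecomposable finite-dimensional `Λ`-modules if and only if there is a bound `b` with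
`ℓ(M) ≤ b` for every indecomposable finite-dimensional `Λ`-module `M`. -/
theorem first_brauer_thrall (k : Type) [Field k] (Λ : Type) [Ring Λ] [Algebra k Λ]
    [FiniteDimensional k Λ] :
    (∃ s : Finset (ModuleCat.{0} Λ),
      ∀ (M : Type) [AddCommGroup M] [Module Λ M] [Module k M] [IsScalarTower k Λ M]
        [FiniteDimensional k M], IsIndecomposableModule Λ M →
          ∃ V ∈ s, Nonempty (M ≃ₗ[Λ] ↥V)) ↔
    (∃ b : ℕ,
      ∀ (M : Type) [AddCommGroup M] [Module Λ M] [Module k M] [IsScalarTower k Λ M]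
        [FiniteDimensional k M], IsIndecomposableModule Λ M → compLength Λ M ≤ b) := by
  have : IsArtinianRing Λ := IsArtinianRing.of_finite k Λ
  constructor
  · rintro ⟨s, hs⟩
    refine ⟨s.sup fun V => (Module.length Λ V).toNat, fun M _ _ _ _ _ hM => ?_⟩
    have : Module.Finite Λ M := Module.Finite.of_restrictScalars_finite k Λ M
    obtain ⟨V, hV, ⟨e⟩⟩ := hs M hM
    have h : compLength Λ M = (Module.length Λ V).toNat := by
      rw [← e.length_eq, ← compLength_eq_length, ENat.toNat_natCast]
    rw [h]
    exact Finset.le_sup (f := fun V : ModuleCat.{0} Λ => (Module.length Λ V).toNat) hV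
  · rintro ⟨b, hb⟩
    obtain ⟨T, hT, hTM⟩ := exists_finite_of_length_le k (Λ := Λ) (b := b) fun C hfin hC => by
      let _ : Module k C := Module.compHom C (algebraMap k Λ)
      have := isScalarTower_compHom k Λ C
      have : FiniteDimensional k C := Module.Finite.trans Λ C
      rw [← compLength_eq_length]
      exact_mod_cast hb C hC
    refine ⟨hT.toFinset, fun M _ _ _ _ _ hM => ?_⟩
    have : Module.Finite Λ M := Module.Finite.of_restrictScalars_finite k Λ M
    simpa using hTM M hM
end
end
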